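/- Let E²(l,3) = {(l₁, l₂, l₃) ∈ ℝ³ : lᵢ > 0 and lᵢ + lⱼ > l_k for every permutation (i,j,k) of (1,2,3)}, and for l ∈ E²(l,3) let θᵢ(l) = arccos((lⱼ² + l_k² − lᵢ²)/(2·lⱼ·l_k)). Then the differential 1-form ω = Σᵢ ln(tan(θᵢ/2)) dlᵢ is closed on E²(l,3); that is, for all i ≠ j, ∂/∂lⱼ [ln(tan(θᵢ(l)/2))] = ∂/∂lᵢ [ln(tan(θⱼ(l)/2))] at every point of E²(l,3). -/

import Mathlib

open Real

/-- The inner angle of a Euclidean triangle opposite the `i`-th edge, as a function of the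
edge lengths `l : Fin 3 → ℝ`. -/
noncomputable def triAngle (l : Fin 3 → ℝ) (i : Fin 3) : ℝ :=
  Real.arccos (((l (i + 1)) ^ 2 + (l (i + 2)) ^ 2 - (l i) ^ 2) / (2 * l (i + 1) * l (i + 2)))

theorem hasDerivAt_log_tan_half_arccos {u : ℝ → ℝ} {u' t : ℝ} (hu : HasDerivAt u u' t)
    (h₁ : -1 < u t) (h₂ : u t < 1) :
    HasDerivAt (fun s => Real.log (Real.tan (Real.arccos (u s) / 2)))
      (-u' / (1 - u t ^ 2)) t := by
  have hθ0 : 0 < Real.arccos (u t) := Real.arccos_pos.2 h₂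
  have hθπ : Real.arccos (u t) < π := by
    refine lt_of_le_of_ne (Real.arccos_le_pi _) fun h => ?_
    linarith [Real.arccos_eq_pi.1 h]
  have hcos : 0 < Real.cos (Real.arccos (u t) / 2) :=
    Real.cos_pos_of_mem_Ioo ⟨by linarith, by linarith⟩
  have hsin : 0 < Real.sin (Real.arccos (u t) / 2) :=
    Real.sin_pos_of_pos_of_lt_pi (by linarith) (by linarith)
  have htan : Real.tan (Real.arccos (u t) / 2) ≠ 0 := by
    rw [Real.tan_eq_sin_div_cos]; positivity
  have hθ := ((Real.hasDerivAt_arccos h₁.ne' h₂.ne).comp t hu).div_const 2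
  have hmain := (HasDerivAt.comp (h₂ := Real.tan) t (Real.hasDerivAt_tan hcos.ne') hθ).log htan
  have hpos : 0 < 1 - u t ^ 2 := by nlinarith
  have hdouble : 2 * Real.sin (Real.arccos (u t) / 2) * Real.cos (Real.arccos (u t) / 2) =
      √(1 - u t ^ 2) := by
    rw [← Real.sin_two_mul, mul_div_cancel₀ _ two_ne_zero, Real.sin_arccos]
  refine hmain.congr_deriv ?_
  simp only [Function.comp_apply, Real.tan_eq_sin_div_cos]
  have hsq : 1 - u t ^ 2 = √(1 - u t ^ 2) * √(1 - u t ^ 2) := (Real.mul_self_sqrt hpos.le).symm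
  rw [hsq, Real.sqrt_mul_self (Real.sqrt_nonneg _), ← hdouble]
  field_simp

/-- The derivative of `log (tan (θ / 2))`, with `θ` the angle opposite the edge `a`, in the
adjacent edge `b`. The value is symmetric in `a` and `b`. -/
theorem hasDerivAt_log_tan_half_angle {a b c : ℝ} (ha : 0 < a) (hb : 0 < b) (hc : 0 < c)
    (habc : a < b + c) (hbca : b < c + a) (hcab : c < a + b) :
    HasDerivAt
      (fun t => Real.log (Real.tan (Real.arccos ((t ^ 2 + c ^ 2 - a ^ 2) / (2 * t * c)) / 2)))
      ((1 / (a + b - c) - 1 / (c + a - b) - 1 / (b + c - a) - 1 / (a + b + c)) / 2) b := by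
  have h₁ : -1 < (b ^ 2 + c ^ 2 - a ^ 2) / (2 * b * c) := by
    rw [lt_div_iff₀ (by positivity)]
    nlinarith [mul_pos (sub_pos.2 habc) (add_pos (add_pos ha hb) hc)]
  have h₂ : (b ^ 2 + c ^ 2 - a ^ 2) / (2 * b * c) < 1 := by
    rw [div_lt_one (by positivity)]
    nlinarith [mul_pos (sub_pos.2 hbca) (sub_pos.2 hcab)]
  have hnum : HasDerivAt (fun t : ℝ => t ^ 2 + c ^ 2 - a ^ 2) (2 * b) b := by
    simpa using ((hasDerivAt_pow 2 b).add_const (c ^ 2)).sub_const (a ^ 2)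
  have hden : HasDerivAt (fun t : ℝ => 2 * t * c) (2 * c) b := by
    simpa using ((hasDerivAt_id b).const_mul 2).mul_const c
  refine (hasDerivAt_log_tan_half_arccos (hnum.fun_div hden (by positivity)) h₁ h₂).congr_deriv ?_
  have e₁ : a + b - c ≠ 0 := by linarith
  have e₂ : c + a - b ≠ 0 := by linarith
  have e₃ : b + c - a ≠ 0 := by linarith
  have e₄ : a + b + c ≠ 0 := by positivity
  have hfac : 1 - ((b ^ 2 + c ^ 2 - a ^ 2) / (2 * b * c)) ^ 2 =
      (a + b - c) * (c + a - b) * (b + c - a) * (a + b + c) / (2 * b * c) ^ 2 := by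
    field_simp
    ring
  rw [hfac]
  field_simp
  ring

/-- The mixed partial derivatives agree for the edges `a` and `b`, with `c` the third edge. -/
theorem deriv_log_tan_half_angle_comm {a b c : ℝ} (ha : 0 < a) (hb : 0 < b) (hc : 0 < c)
    (habc : a < b + c) (hbca : b < c + a) (hcab : c < a + b) :
    deriv (fun t => Real.log (Real.tan
      (Real.arccos ((t ^ 2 + c ^ 2 - a ^ 2) / (2 * t * c)) / 2))) b =
    deriv (fun t => Real.log (Real.tan
      (Real.arccos ((c ^ 2 + t ^ 2 - b ^ 2) / (2 * c * t)) / 2))) a := by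
  have h := hasDerivAt_log_tan_half_angle hb ha hc (by linarith) (by linarith) (by linarith)
  simp only [add_comm (c ^ 2), mul_right_comm 2 c]
  rw [(hasDerivAt_log_tan_half_angle ha hb hc habc hbca hcab).deriv, h.deriv]
  ring

/-- The 1-form `ω = Σᵢ ln(tan(θᵢ/2)) dlᵢ` is closed on the space of Euclidean triangles
parameterized by edge lengths:
`∂/∂lⱼ [ln tan(θᵢ/2)] = ∂/∂lᵢ [ln tan(θⱼ/2)]` for all `i ≠ j`. -/
theorem closed_one_form_log_tan_half
    (l : Fin 3 → ℝ) (hpos : ∀ i, 0 < l i) (htri : ∀ i : Fin 3, l i < l (i + 1) + l (i + 2)) :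
    ∀ i j : Fin 3, i ≠ j →
      deriv (fun t => Real.log (Real.tan (triAngle (Function.update l j t) i / 2))) (l j) =
      deriv (fun t => Real.log (Real.tan (triAngle (Function.update l i t) j / 2))) (l i) := by
  have hcyc : ∀ i : Fin 3,
      deriv (fun t => Real.log (Real.tan (triAngle (Function.update l (i + 1) t) i / 2)))
        (l (i + 1)) =
      deriv (fun t => Real.log (Real.tan (triAngle (Function.update l i t) (i + 1) / 2)))
        (l i) := by
    intro i
    have h := deriv_log_tan_half_angle_comm (hpos i) (hpos (i + 1)) (hpos (i + 2)) (htri i)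
      (by have := htri (i + 1); fin_cases i <;> simpa using this)
      (by have := htri (i + 2); fin_cases i <;> simpa using this)
    fin_cases i <;> simpa [triAngle, Function.update] using h
  intro i j hij
  obtain rfl | rfl : j = i + 1 ∨ i = j + 1 := by
    revert i j; decide
  · exact hcyc i
  · exact (hcyc j).symm
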